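/- arXiv:1505.05737 — 6 statements merged into one kernel-verified Lean document; each statement's English description precedes it below -/
import Mathlib

section
/- (Unimodularity Theorem, necessity.) Let D be a set of primitive vectors in ℤ^n that is not unimodular. Then there exist J ∈ ℕ, finite nonempty sets A^1, …, A^J ⊂ ℤ^n, and concave utility functions u^j : A^j → ℝ of demand type D, together with a point a ∈ conv(A) ∩ ℤ^n (A = A^1 + ⋯ + A^J) such that there is no p ∈ ℝ^n with a ∈ D_{u^1}(p) + ⋯ + D_{u^J}(p), i.e., competitive equilibrium fails at a. -/
open Pointwise

/-- Coercion of an integer vector to a real vector. -/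
def intCoe {n : ℕ} (x : Fin n → ℤ) : Fin n → ℝ := fun i => (x i : ℝ)

/-- Dot product of a real price vector with an integer bundle. -/
noncomputable def dotP {n : ℕ} (p : Fin n → ℝ) (a : Fin n → ℤ) : ℝ := ∑ i, p i * (a i : ℝ)

/-- The demand set of an agent with bundle set `A` and utility `u` at price `p`. -/
def demandSet {n : ℕ} (A : Finset (Fin n → ℤ)) (u : (Fin n → ℤ) → ℝ) (p : Fin n → ℝ) :
    Set (Fin n → ℤ) :=
  {a | a ∈ A ∧ ∀ b ∈ A, u b - dotP p b ≤ u a - dotP p a}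

/-- Aggregate demand set: the Minkowski sum of the individual demand sets. -/
def aggDemand {n J : ℕ} (A : Fin J → Finset (Fin n → ℤ)) (u : Fin J → (Fin n → ℤ) → ℝ)
    (p : Fin n → ℝ) : Set (Fin n → ℤ) :=
  {x | ∃ f : Fin J → (Fin n → ℤ), (∀ j, f j ∈ demandSet (A j) (u j) p) ∧ ∑ j, f j = x}

/-- Aggregate domain: the Minkowski sum of the bundle sets. -/
def aggDomain {n J : ℕ} (A : Fin J → Finset (Fin n → ℤ)) : Set (Fin n → ℤ) :=
  {x | ∃ f : Fin J → (Fin n → ℤ), (∀ j, f j ∈ A j) ∧ ∑ j, f j = x}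

/-- Aggregate utility. -/
noncomputable def aggU {n J : ℕ} (A : Fin J → Finset (Fin n → ℤ)) (u : Fin J → (Fin n → ℤ) → ℝ)
    (a : Fin n → ℤ) : ℝ :=
  sSup {t | ∃ f : Fin J → (Fin n → ℤ), (∀ j, f j ∈ A j) ∧ ∑ j, f j = a ∧ t = ∑ j, u j (f j)}

/-- A vector in `ℤ^n` is primitive if the gcd of its coordinates is 1. -/
def IsPrimitive {n : ℕ} (v : Fin n → ℤ) : Prop := Finset.univ.gcd v = 1

/-- A set of integer vectors is unimodular if every linearly independent subset of `n` of its
vectors is a `ℤ`-basis of `ℤ^n`. -/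
def IsUnimodular {n : ℕ} (D : Set (Fin n → ℤ)) : Prop :=
  ∀ s : Finset (Fin n → ℤ), ↑s ⊆ D → s.card = n →
    LinearIndependent ℤ (fun x : (s : Set (Fin n → ℤ)) => (x : Fin n → ℤ)) →
    Submodule.span ℤ (s : Set (Fin n → ℤ)) = ⊤

/-- Every edge (one-dimensional face, i.e. extreme segment) of `P` is parallel to a vector of `D`. -/
def EdgesParallelTo {n : ℕ} (P : Set (Fin n → ℝ)) (D : Set (Fin n → ℤ)) : Prop :=
  ∀ x y : Fin n → ℝ, x ≠ y → IsExtreme ℝ P (segment ℝ x y) →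
    ∃ v ∈ D, ∃ t : ℝ, y - x = t • intCoe v

/-- A utility function is of demand type `D` if every edge of every demand-set polytope is
parallel to a vector of `D`. -/
def IsDemandType {n : ℕ} (A : Finset (Fin n → ℤ)) (u : (Fin n → ℤ) → ℝ)
    (D : Set (Fin n → ℤ)) : Prop :=
  ∀ p : Fin n → ℝ, EdgesParallelTo (convexHull ℝ (intCoe '' demandSet A u p)) D

/-- A utility function on `A` is concave if `A` contains all lattice points of its convex hull
and `u` is the restriction of a concave function on `conv(A)`. -/
def IsConcaveUtility {n : ℕ} (A : Finset (Fin n → ℤ)) (u : (Fin n → ℤ) → ℝ) : Prop :=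
  (∀ x : Fin n → ℤ, intCoe x ∈ convexHull ℝ (intCoe '' (A : Set (Fin n → ℤ))) → x ∈ A) ∧
  ∃ f : (Fin n → ℝ) → ℝ,
    ConcaveOn ℝ (convexHull ℝ (intCoe '' (A : Set (Fin n → ℤ)))) f ∧
    ∀ a ∈ A, f (intCoe a) = u a

/-- The concave majorant of a function on a finite set of lattice points. -/
noncomputable def concaveMajorant {n : ℕ} (A : Finset (Fin n → ℤ)) (f : (Fin n → ℤ) → ℝ)
    (x : Fin n → ℝ) : ℝ :=
  sSup {t | ∃ lam : (Fin n → ℤ) → ℝ, (∀ d ∈ A, 0 ≤ lam d) ∧ (∑ d ∈ A, lam d) = 1 ∧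
    (∑ d ∈ A, lam d • intCoe d) = x ∧ t = ∑ d ∈ A, lam d * f d}

/-- The aggregate domain as a finite set. -/
def aggFinset {n J : ℕ} (A : Fin J → Finset (Fin n → ℤ)) : Finset (Fin n → ℤ) :=
  Finset.image (fun f => ∑ j, f j) (Fintype.piFinset A)

lemma intCoe_add {n : ℕ} (x y : Fin n → ℤ) : intCoe (x + y) = intCoe x + intCoe y := by
  ext i; simp [intCoe]

lemma intCoe_zero {n : ℕ} : intCoe (0 : Fin n → ℤ) = 0 := by
  ext i; simp [intCoe]

lemma intCoe_zsmul {n : ℕ} (c : ℤ) (x : Fin n → ℤ) : intCoe (c • x) = (c : ℝ) • intCoe x := by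
  ext i; simp [intCoe]

lemma intCoe_sum {n : ℕ} {ι : Type*} (s : Finset ι) (x : ι → Fin n → ℤ) :
    intCoe (∑ j ∈ s, x j) = ∑ j ∈ s, intCoe (x j) := by
  ext i; simp [intCoe]

lemma intCoe_injective {n : ℕ} : Function.Injective (intCoe : (Fin n → ℤ) → Fin n → ℝ) := by
  intro x y h
  ext i
  simpa [intCoe] using congrFun h i

lemma mem_segment_zero_iff {E : Type*} [AddCommGroup E] [Module ℝ E] {x y : E} :
    x ∈ segment ℝ 0 y ↔ ∃ t : ℝ, 0 ≤ t ∧ t ≤ 1 ∧ x = t • y := by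
  rw [segment_eq_image]
  constructor
  · rintro ⟨t, ⟨h0, h1⟩, rfl⟩
    exact ⟨t, h0, h1, by simp⟩
  · rintro ⟨t, h0, h1, rfl⟩
    exact ⟨t, ⟨h0, h1⟩, by simp⟩

lemma convexHull_intCoe_image_pair {n : ℕ} (v : Fin n → ℤ) :
    convexHull ℝ (intCoe '' ({0, v} : Set (Fin n → ℤ))) = segment ℝ 0 (intCoe v) := by
  rw [Set.image_pair, intCoe_zero, convexHull_pair]

/-- The segment from `0` to a primitive vector contains no lattice points but its endpoints. -/
lemma IsPrimitive.eq_zero_or_eq_of_mem_segment {n : ℕ} {v x : Fin n → ℤ} (hv : IsPrimitive v)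
    (hx : intCoe x ∈ segment ℝ 0 (intCoe v)) : x = 0 ∨ x = v := by
  obtain ⟨t, h0, h1, h⟩ := mem_segment_zero_iff.1 hx
  obtain ⟨g, hg⟩ := Finset.gcd_eq_sum_mul Finset.univ v
  rw [show Finset.univ.gcd v = 1 from hv] at hg
  have hgR : (1 : ℝ) = ∑ i, (v i : ℝ) * (g i : ℝ) := by exact_mod_cast hg
  have ht : t = ((∑ i, x i * g i : ℤ) : ℝ) := by
    push_cast
    calc t = t * ∑ i, (v i : ℝ) * (g i : ℝ) := by rw [← hgR, mul_one]
      _ = ∑ i, (x i : ℝ) * (g i : ℝ) := by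
        rw [Finset.mul_sum]
        refine Finset.sum_congr rfl fun i _ => ?_
        have hi : (x i : ℝ) = t * v i := by simpa [intCoe] using congrFun h i
        rw [hi, mul_assoc]
  generalize (∑ i, x i * g i : ℤ) = m at ht
  subst ht
  have hm0 : 0 ≤ m := by exact_mod_cast h0
  have hm1 : m ≤ 1 := by exact_mod_cast h1
  rw [← intCoe_zsmul] at h
  have hxm := intCoe_injective h
  obtain rfl | rfl : m = 0 ∨ m = 1 := by omega
  · left; simpa using hxm
  · right; simpa using hxm

lemma isConcaveUtility_pair {n : ℕ} {v : Fin n → ℤ} (hv : IsPrimitive v) :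
    IsConcaveUtility {0, v} (fun _ => 0) := by
  refine ⟨fun x hx => ?_, fun _ => 0, concaveOn_const _ (convex_convexHull _ _), fun _ _ => rfl⟩
  rw [Finset.coe_pair, convexHull_intCoe_image_pair] at hx
  simpa using hv.eq_zero_or_eq_of_mem_segment hx

lemma isDemandType_pair {n : ℕ} {D : Set (Fin n → ℤ)} {v : Fin n → ℤ} (hv : v ∈ D)
    (u : (Fin n → ℤ) → ℝ) : IsDemandType {0, v} u D := by
  intro p x y _ hext
  have hsub : segment ℝ x y ⊆ segment ℝ 0 (intCoe v) := by
    rw [← convexHull_intCoe_image_pair]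
    refine hext.1.trans (convexHull_mono (Set.image_mono fun a ha => ?_))
    simpa using ha.1
  obtain ⟨r, -, -, rfl⟩ := mem_segment_zero_iff.1 (hsub (left_mem_segment ℝ x y))
  obtain ⟨t, -, -, rfl⟩ := mem_segment_zero_iff.1 (hsub (right_mem_segment ℝ _ y))
  exact ⟨v, hv, t - r, (sub_smul _ _ _).symm⟩

lemma aggDemand_subset_aggDomain {n J : ℕ} (A : Fin J → Finset (Fin n → ℤ))
    (u : Fin J → (Fin n → ℤ) → ℝ) (p : Fin n → ℝ) : aggDemand A u p ⊆ aggDomain A := by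
  rintro x ⟨f, hf, rfl⟩
  exact ⟨f, fun j => (hf j).1, rfl⟩

lemma aggDomain_pair_subset_span {n J : ℕ} (v : Fin J → Fin n → ℤ) :
    aggDomain (fun j => {0, v j}) ⊆ (Submodule.span ℤ (Set.range v) : Set (Fin n → ℤ)) := by
  rintro x ⟨f, hf, rfl⟩
  refine Submodule.sum_mem _ fun j _ => ?_
  have hj := hf j
  simp only [Finset.mem_insert, Finset.mem_singleton] at hj
  rcases hj with h | h <;> rw [h]
  · exact Submodule.zero_mem _
  · exact Submodule.subset_span ⟨j, rfl⟩

lemma intCoe_image_aggDomain {n J : ℕ} (A : Fin J → Finset (Fin n → ℤ)) :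
    intCoe '' aggDomain A = ∑ j, intCoe '' (A j : Set (Fin n → ℤ)) := by
  ext x
  rw [Set.mem_fintype_sum]
  constructor
  · rintro ⟨_, ⟨f, hf, rfl⟩, rfl⟩
    exact ⟨fun j => intCoe (f j), fun j => ⟨f j, hf j, rfl⟩, (intCoe_sum _ _).symm⟩
  · rintro ⟨g, hg, rfl⟩
    choose f hf hfg using hg
    exact ⟨∑ j, f j, ⟨f, hf, rfl⟩, by simp only [intCoe_sum, hfg]⟩

lemma sum_smul_mem_convexHull_aggDomain_pair {n J : ℕ} (v : Fin J → Fin n → ℤ) (t : Fin J → ℝ)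
    (h0 : ∀ j, 0 ≤ t j) (h1 : ∀ j, t j ≤ 1) :
    ∑ j, t j • intCoe (v j) ∈ convexHull ℝ (intCoe '' aggDomain (fun j => {0, v j})) := by
  rw [intCoe_image_aggDomain, convexHull_sum, Set.mem_fintype_sum]
  refine ⟨fun j => t j • intCoe (v j), fun j => ?_, rfl⟩
  rw [Finset.coe_pair, convexHull_intCoe_image_pair]
  exact mem_segment_zero_iff.2 ⟨t j, h0 j, h1 j, rfl⟩

/-- Every lattice vector is a real combination of `n` linearly independent lattice vectors. -/
lemma exists_intCoe_eq_sum_smul {n : ℕ} {v : Fin n → Fin n → ℤ} (hv : LinearIndependent ℤ v)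
    (z : Fin n → ℤ) : ∃ r : Fin n → ℝ, intCoe z = ∑ j, r j • intCoe (v j) := by
  have hdep : ¬ LinearIndependent ℤ (fun o : Option (Fin n) => o.elim z v) := by
    intro h
    have := h.fintype_card_le_finrank
    simp at this
  obtain ⟨c, hc, hne⟩ := Fintype.not_linearIndependent_iff.1 hdep
  simp only [Fintype.sum_option, Option.elim_none, Option.elim_some] at hc
  have hc0 : c none ≠ 0 := by
    intro h
    rw [h, zero_smul, zero_add] at hc
    have hall := Fintype.linearIndependent_iff.1 hv _ hc
    obtain ⟨_ | j, hj⟩ := hne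
    · exact hj h
    · exact hj (hall j)
  have hc0' : (c none : ℝ) ≠ 0 := by exact_mod_cast hc0
  refine ⟨fun j => -(c (some j) : ℝ) / c none, ?_⟩
  have hR := congrArg intCoe hc
  simp only [intCoe_add, intCoe_sum, intCoe_zsmul, intCoe_zero] at hR
  calc intCoe z = (c none : ℝ)⁻¹ • ((c none : ℝ) • intCoe z) := by
        rw [smul_smul, inv_mul_cancel₀ hc0', one_smul]
    _ = _ := by
        rw [eq_neg_of_add_eq_zero_left hR, ← Finset.sum_neg_distrib, Finset.smul_sum]
        refine Finset.sum_congr rfl fun j _ => ?_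
        rw [← neg_smul, smul_smul, ← div_eq_inv_mul]

/-- If `n` linearly independent lattice vectors do not span `ℤ^n`, then the half-open
parallelepiped they generate contains a lattice point outside of their span. -/
lemma exists_intCoe_eq_sum_fract_smul {n : ℕ} {v : Fin n → Fin n → ℤ}
    (hv : LinearIndependent ℤ v) (hspan : Submodule.span ℤ (Set.range v) ≠ ⊤) :
    ∃ (a : Fin n → ℤ) (r : Fin n → ℝ), a ∉ Submodule.span ℤ (Set.range v) ∧
      intCoe a = ∑ j, Int.fract (r j) • intCoe (v j) := by
  obtain ⟨z, hz⟩ := SetLike.exists_not_mem_of_ne_top _ hspan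
  obtain ⟨r, hr⟩ := exists_intCoe_eq_sum_smul hv z
  have hfloor : ∑ j, (-⌊r j⌋) • v j ∈ Submodule.span ℤ (Set.range v) :=
    Submodule.sum_mem _ fun j _ => Submodule.smul_mem _ _ (Submodule.subset_span ⟨j, rfl⟩)
  refine ⟨z + ∑ j, (-⌊r j⌋) • v j, r, fun h => hz ((Submodule.add_mem_iff_left _ hfloor).1 h), ?_⟩
  rw [intCoe_add, intCoe_sum, hr, ← Finset.sum_add_distrib]
  refine Finset.sum_congr rfl fun j _ => ?_
  rw [intCoe_zsmul, ← add_smul, ← Int.self_sub_floor]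
  push_cast
  rw [sub_eq_add_neg]

/-- Unimodularity Theorem, necessity: if `D` is a set of primitive vectors which is
not unimodular, then there are concave utilities of demand type `D` and a lattice point of the
convex hull of the aggregate domain at which competitive equilibrium fails. -/
theorem stmt2 {n : ℕ} (D : Set (Fin n → ℤ)) (hprim : ∀ v ∈ D, IsPrimitive v)
    (hD : ¬ IsUnimodular D) :
    ∃ (J : ℕ) (A : Fin J → Finset (Fin n → ℤ)) (u : Fin J → (Fin n → ℤ) → ℝ),
      (∀ j, (A j).Nonempty) ∧ (∀ j, IsConcaveUtility (A j) (u j)) ∧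
      (∀ j, IsDemandType (A j) (u j) D) ∧
      ∃ a : Fin n → ℤ, intCoe a ∈ convexHull ℝ (intCoe '' aggDomain A) ∧
        ∀ p : Fin n → ℝ, a ∉ aggDemand A u p := by
  simp only [IsUnimodular, not_forall] at hD
  obtain ⟨s, hsD, hcard, hli, hspan⟩ := hD
  let e : Fin n ≃ s := (s.equivFinOfCardEq hcard).symm
  let v : Fin n → Fin n → ℤ := fun j => (e j : Fin n → ℤ)
  have hvD : ∀ j, v j ∈ D := fun j => hsD (e j).2
  have hv : LinearIndependent ℤ v := hli.comp e e.injective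
  have hrange : Set.range v = (s : Set (Fin n → ℤ)) := by
    change Set.range (Subtype.val ∘ e) = _
    rw [e.surjective.range_comp]
    exact Subtype.range_coe
  obtain ⟨a, r, ha, har⟩ := exists_intCoe_eq_sum_fract_smul hv (by rwa [hrange])
  refine ⟨n, fun j => {0, v j}, fun _ _ => 0, fun j => Finset.insert_nonempty _ _,
    fun j => isConcaveUtility_pair (hprim _ (hvD j)), fun j => isDemandType_pair (hvD j) _,
    a, ?_, fun p hp => ha (aggDomain_pair_subset_span v (aggDemand_subset_aggDomain _ _ p hp))⟩
  rw [har]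
  exact sum_smul_mem_convexHull_aggDomain_pair v _ (fun j => Int.fract_nonneg _)
    fun j => (Int.fract_lt_one _).le
end

section
/- Let u^1, …, u^J be utility functions on finite nonempty sets A^1, …, A^J ⊂ ℤ^n, with aggregate domain A = A^1 + ⋯ + A^J and aggregate utility U. Competitive equilibrium exists over conv(A) (i.e., at every point of conv(A) ∩ ℤ^n) if and only if A = conv(A) ∩ ℤ^n and U can be extended to a concave function on conv(A). -/
open Pointwise

/-- **Farkas' lemma** for finitely many linear functionals on a real vector space. -/
theorem exists_nonneg_sum_eq_of_forall_nonpos {ι V : Type*} [AddCommGroup V] [Module ℝ V]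
    (s : Finset ι) (φ : ι → V →ₗ[ℝ] ℝ) (ψ : V →ₗ[ℝ] ℝ)
    (h : ∀ x, (∀ i ∈ s, φ i x ≤ 0) → ψ x ≤ 0) :
    ∃ w : ι → ℝ, (∀ i ∈ s, 0 ≤ w i) ∧ ∀ x, ψ x = ∑ i ∈ s, w i * φ i x := by
  classical
  induction s using Finset.induction_on generalizing φ ψ with
  | empty =>
    refine ⟨0, by simp, fun x => ?_⟩
    have h₁ := h x (by simp)
    have h₂ := h (-x) (by simp)
    rw [map_neg] at h₂
    rw [Finset.sum_empty]
    linarith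
  | insert k s hk ih =>
    by_cases hs : ∀ x, (∀ i ∈ s, φ i x ≤ 0) → ψ x ≤ 0
    · obtain ⟨w, hw, hψ⟩ := ih φ ψ hs
      refine ⟨Function.update w k 0, fun i hi => ?_, fun x => ?_⟩
      · rcases eq_or_ne i k with rfl | hik
        · simp
        · simpa [hik] using hw i (Finset.mem_of_mem_insert_of_ne hi hik)
      · rw [Finset.sum_insert hk, hψ x, Function.update_self, zero_mul, zero_add]
        refine Finset.sum_congr rfl fun i hi => ?_
        rw [Function.update_of_ne (ne_of_mem_of_not_mem hi hk)]
    · push Not at hs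
      obtain ⟨y, hy, hψy⟩ := hs
      have hky : 0 < φ k y := by
        by_contra! hky
        refine hψy.not_ge (h y fun i hi => ?_)
        rcases Finset.mem_insert.1 hi with rfl | hi
        exacts [hky, hy i hi]
      -- Project along `y` onto the kernel of `φ k`.
      obtain ⟨w, hw, hψ⟩ := ih (fun i => φ i - (φ i y / φ k y) • φ k)
        (ψ - (ψ y / φ k y) • φ k) fun x hx => by
          have key (χ : V →ₗ[ℝ] ℝ) :
              (χ - (χ y / φ k y) • φ k) x = χ (x - (φ k x / φ k y) • y) := by
            simp only [LinearMap.sub_apply, LinearMap.smul_apply, map_sub, map_smul, smul_eq_mul]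
            ring
          rw [key]
          refine h _ fun i hi => ?_
          rcases Finset.mem_insert.1 hi with rfl | hi
          · rw [map_sub, map_smul, smul_eq_mul, div_mul_cancel₀ _ hky.ne', sub_self]
          · rw [← key]
            exact hx i hi
      refine ⟨Function.update w k ((ψ y - ∑ i ∈ s, w i * φ i y) / φ k y), fun i hi => ?_,
        fun x => ?_⟩
      · rcases eq_or_ne i k with rfl | hik
        · rw [Function.update_self]
          have : ∑ i ∈ s, w i * φ i y ≤ 0 :=
            Finset.sum_nonpos fun i hi => mul_nonpos_of_nonneg_of_nonpos (hw i hi) (hy i hi)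
          exact div_nonneg (by linarith) hky.le
        · simpa [hik] using hw i (Finset.mem_of_mem_insert_of_ne hi hik)
      · have hx := hψ x
        simp only [LinearMap.sub_apply, LinearMap.smul_apply, smul_eq_mul, mul_sub,
          Finset.sum_sub_distrib] at hx
        have hsum : ∑ i ∈ s, w i * (φ i y / φ k y * φ k x) =
            (∑ i ∈ s, w i * φ i y) / φ k y * φ k x := by
          rw [Finset.sum_div, Finset.sum_mul]
          exact Finset.sum_congr rfl fun i _ => by ring
        have hupd : ∑ i ∈ s, Function.update w k ((ψ y - ∑ i ∈ s, w i * φ i y) / φ k y) i * φ i x =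
            ∑ i ∈ s, w i * φ i x :=
          Finset.sum_congr rfl fun i hi => by
            rw [Function.update_of_ne (ne_of_mem_of_not_mem hi hk)]
        rw [Finset.sum_insert hk, Function.update_self, hupd, sub_div, sub_mul]
        linarith

theorem dotP_sum {n : ℕ} {ι : Type*} (s : Finset ι) (p : Fin n → ℝ) (f : ι → Fin n → ℤ) :
    dotP p (∑ j ∈ s, f j) = ∑ j ∈ s, dotP p (f j) := by
  simp only [dotP, Finset.sum_apply, Int.cast_sum, Finset.mul_sum]
  exact Finset.sum_comm

/-- A function on a finite set of lattice points that is the restriction of a concave function on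
the convex hull has a supporting price at each of these points. -/
theorem exists_supporting_price {n : ℕ} (S : Finset (Fin n → ℤ)) (U : (Fin n → ℤ) → ℝ)
    (f : (Fin n → ℝ) → ℝ)
    (hf : ConcaveOn ℝ (convexHull ℝ (intCoe '' (S : Set (Fin n → ℤ)))) f)
    (hfU : ∀ b ∈ S, f (intCoe b) = U b) {a : Fin n → ℤ} (ha : a ∈ S) :
    ∃ p : Fin n → ℝ, ∀ b ∈ S, U b - dotP p b ≤ U a - dotP p a := by
  by_contra! hp
  let φ (b : Fin n → ℤ) : ((Fin n → ℝ) × ℝ) →ₗ[ℝ] ℝ :=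
    (∑ i, ((a i : ℝ) - b i) • LinearMap.proj i) ∘ₗ LinearMap.fst ℝ _ _ +
      (U b - U a) • LinearMap.snd ℝ _ _
  have hφ (b : Fin n → ℤ) (q : Fin n → ℝ) (t : ℝ) :
      φ b (q, t) = dotP q a - dotP q b + (U b - U a) * t := by
    simp only [φ, dotP, LinearMap.add_apply, LinearMap.comp_apply, LinearMap.sum_apply,
      LinearMap.smul_apply, LinearMap.fst_apply, LinearMap.snd_apply, LinearMap.proj_apply,
      smul_eq_mul, ← Finset.sum_sub_distrib]
    congr 1
    exact Finset.sum_congr rfl fun i _ => by ring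
  obtain ⟨w, hw, hsnd⟩ := exists_nonneg_sum_eq_of_forall_nonpos S φ (LinearMap.snd ℝ _ _) <| by
    rintro ⟨q, t⟩ hq
    by_contra! ht
    rw [LinearMap.snd_apply] at ht
    obtain ⟨b, hb, hlt⟩ := hp (t⁻¹ • q)
    have hscale (c : Fin n → ℤ) : dotP (t⁻¹ • q) c = t⁻¹ * dotP q c := by
      simp [dotP, Finset.mul_sum, mul_assoc]
    rw [hscale, hscale] at hlt
    have h₁ := hq b hb
    rw [hφ] at h₁
    have h₂ := mul_lt_mul_of_pos_right hlt ht
    have h₃ : t⁻¹ * t = 1 := inv_mul_cancel₀ ht.ne'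
    have h₄ (c : Fin n → ℤ) : (U c - t⁻¹ * dotP q c) * t = U c * t - dotP q c := by
      linear_combination -dotP q c * h₃
    rw [h₄, h₄] at h₂
    linarith
  have hone : ∑ b ∈ S, w b * U b - (∑ b ∈ S, w b) * U a = 1 := by
    have := hsnd (0, 1)
    simp only [hφ, LinearMap.snd_apply] at this
    rw [this, Finset.sum_mul, ← Finset.sum_sub_distrib]
    exact Finset.sum_congr rfl fun b _ => by simp [dotP]; ring
  have hzero (i : Fin n) : ∑ b ∈ S, w b * (b i : ℝ) = (∑ b ∈ S, w b) * a i := by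
    have := hsnd (Pi.single i 1, 0)
    simp only [hφ, LinearMap.snd_apply] at this
    rw [← sub_eq_zero, ← neg_eq_zero, this, Finset.sum_mul, ← Finset.sum_sub_distrib,
      ← Finset.sum_neg_distrib]
    refine Finset.sum_congr rfl fun b _ => ?_
    simp [dotP, Pi.single_apply]
    ring
  have hpos : 0 < ∑ b ∈ S, w b := by
    refine (Finset.sum_nonneg hw).lt_of_ne' fun h0 => ?_
    rw [h0, Finset.sum_congr rfl (g := fun _ => (0 : ℝ))
      (fun b hb => by rw [(Finset.sum_eq_zero_iff_of_nonneg hw).1 h0 b hb, zero_mul])] at hone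
    simp at hone
  have hcenter : S.centerMass w intCoe = intCoe a := by
    ext i
    simp only [Finset.centerMass, Pi.smul_apply, Finset.sum_apply, smul_eq_mul, intCoe]
    rw [hzero, inv_mul_cancel_left₀ hpos.ne']
  have hle := hf.le_map_centerMass hw hpos
    fun b hb => subset_convexHull ℝ _ (Set.mem_image_of_mem intCoe hb)
  rw [hcenter, hfU a ha, Finset.centerMass, smul_eq_mul, inv_mul_le_iff₀ hpos,
    Finset.sum_congr rfl (g := fun b => w b * U b)
      (fun b hb => by simp [hfU b hb])] at hle
  linarith

theorem coe_aggFinset {n J : ℕ} (A : Fin J → Finset (Fin n → ℤ)) :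
    (aggFinset A : Set (Fin n → ℤ)) = aggDomain A := by
  ext x
  simp [aggFinset, aggDomain]

theorem mem_aggFinset {n J : ℕ} {A : Fin J → Finset (Fin n → ℤ)} {x : Fin n → ℤ} :
    x ∈ aggFinset A ↔ x ∈ aggDomain A := by
  rw [← coe_aggFinset, Finset.mem_coe]

theorem finite_aggU_values {n J : ℕ} (A : Fin J → Finset (Fin n → ℤ))
    (u : Fin J → (Fin n → ℤ) → ℝ) (a : Fin n → ℤ) :
    {t | ∃ f : Fin J → (Fin n → ℤ),
      (∀ j, f j ∈ A j) ∧ ∑ j, f j = a ∧ t = ∑ j, u j (f j)}.Finite := by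
  refine ((Fintype.piFinset A).finite_toSet.image fun f => ∑ j, u j (f j)).subset ?_
  rintro t ⟨f, hf, -, rfl⟩
  exact ⟨f, by simpa using hf, rfl⟩

theorem sum_le_aggU {n J : ℕ} {A : Fin J → Finset (Fin n → ℤ)} (u : Fin J → (Fin n → ℤ) → ℝ)
    {f : Fin J → (Fin n → ℤ)} (hf : ∀ j, f j ∈ A j) :
    ∑ j, u j (f j) ≤ aggU A u (∑ j, f j) :=
  le_csSup (finite_aggU_values A u _).bddAbove ⟨f, hf, rfl, rfl⟩

theorem exists_aggU_eq {n J : ℕ} {A : Fin J → Finset (Fin n → ℤ)} (u : Fin J → (Fin n → ℤ) → ℝ)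
    {a : Fin n → ℤ} (ha : a ∈ aggDomain A) :
    ∃ f : Fin J → (Fin n → ℤ),
      (∀ j, f j ∈ A j) ∧ ∑ j, f j = a ∧ aggU A u a = ∑ j, u j (f j) := by
  obtain ⟨f, hf, hfa⟩ := ha
  have hne : {t | ∃ f : Fin J → (Fin n → ℤ),
      (∀ j, f j ∈ A j) ∧ ∑ j, f j = a ∧ t = ∑ j, u j (f j)}.Nonempty := ⟨_, f, hf, hfa, rfl⟩
  exact hne.csSup_mem (finite_aggU_values A u a)

/-- Aggregate demand is the demand of the aggregate utility. -/
theorem mem_aggDemand_iff {n J : ℕ} {A : Fin J → Finset (Fin n → ℤ)}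
    {u : Fin J → (Fin n → ℤ) → ℝ} {p : Fin n → ℝ} {a : Fin n → ℤ} :
    a ∈ aggDemand A u p ↔ a ∈ aggDomain A ∧
      ∀ b ∈ aggDomain A, aggU A u b - dotP p b ≤ aggU A u a - dotP p a := by
  constructor
  · rintro ⟨f, hf, rfl⟩
    refine ⟨⟨f, fun j => (hf j).1, rfl⟩, fun b hb => ?_⟩
    obtain ⟨g, hg, rfl, hU⟩ := exists_aggU_eq u hb
    calc aggU A u (∑ j, g j) - dotP p (∑ j, g j)
        = ∑ j, (u j (g j) - dotP p (g j)) := by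
          rw [hU, dotP_sum, Finset.sum_sub_distrib]
      _ ≤ ∑ j, (u j (f j) - dotP p (f j)) :=
          Finset.sum_le_sum fun j _ => (hf j).2 _ (hg j)
      _ ≤ aggU A u (∑ j, f j) - dotP p (∑ j, f j) := by
          rw [dotP_sum, Finset.sum_sub_distrib]
          gcongr
          exact sum_le_aggU u fun j => (hf j).1
  · rintro ⟨ha, hmax⟩
    obtain ⟨f, hf, rfl, hU⟩ := exists_aggU_eq u ha
    refine ⟨f, fun j => ⟨hf j, fun b hb => ?_⟩, rfl⟩
    by_contra! hlt
    have hg : ∀ i, Function.update f j b i ∈ A i := by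
      intro i
      rcases eq_or_ne i j with rfl | hij
      · simpa using hb
      · simpa [hij] using hf i
    have h₁ := hmax _ ⟨_, hg, rfl⟩
    have h₂ := sum_le_aggU u hg
    have h₃ : ∑ i, (u i (f i) - dotP p (f i)) <
        ∑ i, (u i (Function.update f j b i) - dotP p (Function.update f j b i)) := by
      refine Finset.sum_lt_sum (fun i _ => ?_) ⟨j, Finset.mem_univ j, by simpa using hlt⟩
      rcases eq_or_ne i j with rfl | hij
      · simpa using hlt.le
      · simp [hij]
    rw [Finset.sum_sub_distrib, Finset.sum_sub_distrib, ← dotP_sum, ← dotP_sum, ← hU] at h₃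
    linarith

/-- A function on a finite set of lattice points with a supporting price at each of them is the
restriction of a concave function. -/
theorem exists_concaveOn_extension {n : ℕ} {S : Finset (Fin n → ℤ)} (hS : S.Nonempty)
    (U : (Fin n → ℤ) → ℝ)
    (h : ∀ a ∈ S, ∃ p : Fin n → ℝ, ∀ b ∈ S, U b - dotP p b ≤ U a - dotP p a) :
    ∃ f : (Fin n → ℝ) → ℝ, ConcaveOn ℝ Set.univ f ∧ ∀ a ∈ S, f (intCoe a) = U a := by
  choose! p hp using h
  refine ⟨fun x => S.inf' hS fun a => U a - dotP (p a) a + ∑ i, p a i * x i,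
    ⟨convex_univ, fun x _ y _ s t hs ht hst => ?_⟩, fun a ha => le_antisymm ?_ ?_⟩
  · refine Finset.le_inf' _ _ fun a ha => ?_
    calc s • (S.inf' hS fun a => U a - dotP (p a) a + ∑ i, p a i * x i) +
          t • (S.inf' hS fun a => U a - dotP (p a) a + ∑ i, p a i * y i)
        ≤ s • (U a - dotP (p a) a + ∑ i, p a i * x i) +
          t • (U a - dotP (p a) a + ∑ i, p a i * y i) := by
          gcongr <;> exact Finset.inf'_le _ ha
      _ = (s + t) * (U a - dotP (p a) a) + ∑ i, p a i * (s • x + t • y) i := by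
          have hsum : ∑ i, p a i * (s • x + t • y) i =
              s * ∑ i, p a i * x i + t * ∑ i, p a i * y i := by
            rw [Finset.mul_sum, Finset.mul_sum, ← Finset.sum_add_distrib]
            refine Finset.sum_congr rfl fun i _ => ?_
            simp only [Pi.add_apply, Pi.smul_apply, smul_eq_mul]
            ring
          rw [hsum, smul_eq_mul, smul_eq_mul]
          ring
      _ = U a - dotP (p a) a + ∑ i, p a i * (s • x + t • y) i := by rw [hst, one_mul]
  · refine (Finset.inf'_le _ ha).trans_eq ?_
    exact sub_add_cancel _ _
  · refine Finset.le_inf' _ _ fun b hb => ?_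
    change U a ≤ U b - dotP (p b) b + dotP (p b) a
    linarith [hp b hb a ha]

/-- competitive equilibrium exists over `conv(A)` iff `A` contains all lattice points
of its convex hull and the aggregate utility extends to a concave function on `conv(A)`. -/
theorem stmt4 {n J : ℕ} (A : Fin J → Finset (Fin n → ℤ)) (u : Fin J → (Fin n → ℤ) → ℝ)
    (hA : ∀ j, (A j).Nonempty) :
    (∀ a : Fin n → ℤ, intCoe a ∈ convexHull ℝ (intCoe '' aggDomain A) →
        ∃ p : Fin n → ℝ, a ∈ aggDemand A u p) ↔
      ((∀ x : Fin n → ℤ, intCoe x ∈ convexHull ℝ (intCoe '' aggDomain A) → x ∈ aggDomain A) ∧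
        ∃ f : (Fin n → ℝ) → ℝ, ConcaveOn ℝ (convexHull ℝ (intCoe '' aggDomain A)) f ∧
          ∀ a ∈ aggDomain A, f (intCoe a) = aggU A u a) := by
  constructor
  · intro h
    have hmem (x : Fin n → ℤ) (hx : intCoe x ∈ convexHull ℝ (intCoe '' aggDomain A)) :
        x ∈ aggDomain A := by
      obtain ⟨p, hp⟩ := h x hx
      exact (mem_aggDemand_iff.1 hp).1
    have hne : (aggFinset A).Nonempty := (Fintype.piFinset_nonempty.2 hA).image _
    obtain ⟨f, hf, hfU⟩ := exists_concaveOn_extension hne (aggU A u) fun a ha => by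
      obtain ⟨p, hp⟩ := h a (subset_convexHull ℝ _ ⟨a, mem_aggFinset.1 ha, rfl⟩)
      exact ⟨p, fun b hb => (mem_aggDemand_iff.1 hp).2 b (mem_aggFinset.1 hb)⟩
    exact ⟨hmem, f, hf.subset (Set.subset_univ _) (convex_convexHull ℝ _),
      fun a ha => hfU a (mem_aggFinset.2 ha)⟩
  · rintro ⟨hmem, f, hf, hfU⟩ a ha
    rw [← coe_aggFinset] at hf
    obtain ⟨p, hp⟩ := exists_supporting_price (aggFinset A) (aggU A u) f hf
      (fun b hb => hfU b (mem_aggFinset.1 hb)) (mem_aggFinset.2 (hmem a ha))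
    exact ⟨p, mem_aggDemand_iff.2 ⟨hmem a ha, fun b hb => hp b (mem_aggFinset.2 hb)⟩⟩
end

section
/- Let u^1, …, u^J be utility functions on finite nonempty sets A^1, …, A^J ⊂ ℤ^n, and let a* ∈ ℤ^n. Suppose y* assigns to each agent j a unique bundle a^j ∈ A^j (i.e., y*(a,j) ∈ {0,1} with Σ_{a ∈ A^j} y*(a,j) = 1), that Σ_j a^j = a*, and that Σ_j u^j(a^j) is maximal among all such integral assignments and, moreover, that competitive equilibrium exists at a*. Then {p ∈ ℝ^n : a^j ∈ D_{u^j}(p) for every j = 1,…,J} = {p ∈ ℝ^n : a* ∈ D_U(p)}. In particular, maximizing p·a* over the first set finds a profit-maximizing equilibrium price. -/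
open Pointwise

theorem sum_dotP {n J : ℕ} (p : Fin n → ℝ) (g : Fin J → (Fin n → ℤ)) :
    ∑ j, dotP p (g j) = dotP p (∑ j, g j) := by
  simp only [dotP, Finset.sum_apply, Int.cast_sum, Finset.mul_sum]
  exact Finset.sum_comm

/-- An assignment that is feasible, and has the same aggregate bundle as an assignment of demanded
bundles but at least as much total utility, itself assigns demanded bundles. -/
theorem mem_demandSet_of_sum_le {n J : ℕ} {A : Fin J → Finset (Fin n → ℤ)}
    {u : Fin J → (Fin n → ℤ) → ℝ} {p : Fin n → ℝ} {f g : Fin J → (Fin n → ℤ)}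
    (hf : ∀ j, f j ∈ A j) (hg : ∀ j, g j ∈ demandSet (A j) (u j) p)
    (hsum : ∑ j, f j = ∑ j, g j) (hle : ∑ j, u j (g j) ≤ ∑ j, u j (f j)) (j : Fin J) :
    f j ∈ demandSet (A j) (u j) p := by
  have hterm : ∀ i ∈ Finset.univ,
      u i (f i) - dotP p (f i) ≤ u i (g i) - dotP p (g i) := fun i _ => (hg i).2 _ (hf i)
  have htotal : ∑ i, (u i (f i) - dotP p (f i)) = ∑ i, (u i (g i) - dotP p (g i)) := by
    refine le_antisymm (Finset.sum_le_sum hterm) ?_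
    rw [Finset.sum_sub_distrib, Finset.sum_sub_distrib, sum_dotP, sum_dotP, hsum]
    exact sub_le_sub_right hle _
  have heq := (Finset.sum_eq_sum_iff_of_le hterm).1 htotal j (Finset.mem_univ j)
  exact ⟨hf j, fun b hb => heq ▸ (hg j).2 b hb⟩

/-- if `f` is an optimal integral assignment summing to `a*` and competitive
equilibrium exists at `a*`, then the prices at which every agent `j` demands `f j` are exactly the
prices at which `a*` is in the aggregate demand set. -/
theorem stmt7 {n J : ℕ} (A : Fin J → Finset (Fin n → ℤ)) (u : Fin J → (Fin n → ℤ) → ℝ)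
    (hA : ∀ j, (A j).Nonempty) (astar : Fin n → ℤ)
    (f : Fin J → (Fin n → ℤ)) (hf : ∀ j, f j ∈ A j) (hfsum : ∑ j, f j = astar)
    (hopt : ∀ g : Fin J → (Fin n → ℤ), (∀ j, g j ∈ A j) → ∑ j, g j = astar →
      (∑ j, u j (g j)) ≤ ∑ j, u j (f j))
    (hCE : ∃ p : Fin n → ℝ, astar ∈ aggDemand A u p) :
    {p : Fin n → ℝ | ∀ j, f j ∈ demandSet (A j) (u j) p} =
      {p : Fin n → ℝ | astar ∈ aggDemand A u p} := by
  ext p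
  refine ⟨fun h => ⟨f, h, hfsum⟩, ?_⟩
  rintro ⟨g, hg, hgsum⟩
  exact mem_demandSet_of_sum_le hf hg (hfsum.trans hgsum.symm)
    (hopt g (fun j => (hg j).1) hgsum)
end

section
/- Let n ≥ 1 and let v : 2^{[n]} → ℝ_{≥0} with v(∅) = 0 be the characteristic function of a stable matching game with transferable utility. For each nonempty coalition a ⊆ [n], consider an auction agent with bundle set {0, χ_a} ⊂ ℤ^n (χ_a the 0/1 indicator vector of a) and utility v^a(0) = 0, v^a(χ_a) = v(a). Then the TU-game has a core — i.e., there exist a partition P of [n] into nonempty coalitions and a function u : [n] → ℝ_{≥0} with Σ_{i ∈ a} u(i) = v(a) for every a ∈ P and Σ_{i ∈ b} u(i) ≥ v(b) for every nonempty b ⊆ [n] — if and only if there exist a price p ∈ ℝ^n and, for each nonempty coalition a, a choice x_a ∈ D_{v^a}(p) such that Σ_a x_a = (1,1,…,1), i.e., the associated product-mix auction has a competitive equilibrium at (1,…,1). -/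
open Pointwise

/-- The 0/1 indicator vector of a coalition. -/
def coalVec {n : ℕ} (a : Finset (Fin n)) : Fin n → ℤ := fun i => if i ∈ a then 1 else 0

theorem dotP_coalVec {n : ℕ} (p : Fin n → ℝ) (a : Finset (Fin n)) :
    dotP p (coalVec a) = ∑ i ∈ a, p i := by
  simp [dotP, coalVec]

theorem coalVec_ne_zero {n : ℕ} {a : Finset (Fin n)} (ha : a.Nonempty) : coalVec a ≠ 0 := by
  obtain ⟨i, hi⟩ := ha
  intro h
  simpa [coalVec, hi] using congrFun h i

/-- A single-bundle agent demands its bundle when the price is at most the value, and the zero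
bundle when the price is at least the value. -/
theorem mem_demandSet_coalVec {n : ℕ} {a : Finset (Fin n)} (ha : a.Nonempty) (r : ℝ)
    (p : Fin n → ℝ) (x : Fin n → ℤ) :
    x ∈ demandSet {0, coalVec a} (fun z => if z = coalVec a then r else 0) p ↔
      (x = coalVec a ∧ ∑ i ∈ a, p i ≤ r) ∨ (x = 0 ∧ r ≤ ∑ i ∈ a, p i) := by
  have h0 := coalVec_ne_zero ha
  have hz : dotP p 0 = 0 := by simp [dotP]
  simp only [demandSet, Set.mem_ofPred_eq, Finset.mem_insert, Finset.mem_singleton,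
    forall_eq_or_imp, forall_eq]
  constructor
  · rintro ⟨rfl | rfl, h⟩ <;> simp [h0.symm, hz, dotP_coalVec] at h
    · exact Or.inr ⟨rfl, h⟩
    · exact Or.inl ⟨rfl, h⟩
  · rintro (⟨rfl, h⟩ | ⟨rfl, h⟩) <;> simp [h0.symm, hz, dotP_coalVec, h]

/-- A family of coalitions partitions the players iff its indicator vectors sum to one. -/
theorem sum_coalVec_eq_one_iff {n : ℕ} (P : Finset (Finset (Fin n))) :
    ∑ a ∈ P, coalVec a = (fun _ => 1) ↔ ∀ i, ∃! a, a ∈ P ∧ i ∈ a := by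
  rw [funext_iff]
  refine forall_congr' fun i => ?_
  have h : (∑ a ∈ P, coalVec a) i = ((P.filter (i ∈ ·)).card : ℤ) := by
    simp [Finset.sum_apply, coalVec]
  rw [h, Nat.cast_eq_one, Finset.card_eq_one, Finset.singleton_iff_unique_mem]
  simp

/-- Prices at which every block of a partition is affordable can be raised so that each block
costs exactly its value. -/
theorem exists_ge_sum_eq {n : ℕ} {P : Finset (Finset (Fin n))} {v : Finset (Fin n) → ℝ}
    {p : Fin n → ℝ} (hne : ∀ a ∈ P, a.Nonempty) (hP : ∀ i, ∃! a, a ∈ P ∧ i ∈ a)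
    (hp : ∀ a ∈ P, ∑ i ∈ a, p i ≤ v a) :
    ∃ u : Fin n → ℝ, (∀ i, p i ≤ u i) ∧ ∀ a ∈ P, ∑ i ∈ a, u i = v a := by
  choose B hB hBu using hP
  refine ⟨fun i => p i + (v (B i) - ∑ j ∈ B i, p j) / (B i).card, fun i => ?_, fun a ha => ?_⟩
  · have := sub_nonneg.2 (hp _ (hB i).1)
    exact le_add_of_nonneg_right (by positivity)
  · have hBa : ∀ i ∈ a, B i = a := fun i hi => (hBu i a ⟨ha, hi⟩).symm
    have hc : (a.card : ℝ) ≠ 0 := by exact_mod_cast (hne a ha).card_pos.ne'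
    calc ∑ i ∈ a, (p i + (v (B i) - ∑ j ∈ B i, p j) / (B i).card)
        = ∑ i ∈ a, (p i + (v a - ∑ j ∈ a, p j) / a.card) :=
          Finset.sum_congr rfl fun i hi => by rw [hBa i hi]
      _ = v a := by
          rw [Finset.sum_add_distrib, Finset.sum_const, nsmul_eq_mul, mul_div_cancel₀ _ hc]
          ring

/-- a TU-game has a core iff the associated product-mix auction (one agent per
nonempty coalition, bidding on `{0, χ_a}`) has a competitive equilibrium at `(1,…,1)`. -/
theorem stmt8 (n : ℕ) (hn : 1 ≤ n) (v : Finset (Fin n) → ℝ)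
    (hv0 : v ∅ = 0) (hvnn : ∀ a, 0 ≤ v a) :
    (∃ (P : Finset (Finset (Fin n))) (u : Fin n → ℝ),
        (∀ a ∈ P, a.Nonempty) ∧
        (∀ i : Fin n, ∃! a, a ∈ P ∧ i ∈ a) ∧
        (∀ i, 0 ≤ u i) ∧
        (∀ a ∈ P, (∑ i ∈ a, u i) = v a) ∧
        (∀ b : Finset (Fin n), b.Nonempty → v b ≤ ∑ i ∈ b, u i)) ↔
      (∃ (p : Fin n → ℝ) (x : Finset (Fin n) → (Fin n → ℤ)),
        (∀ a : Finset (Fin n), a.Nonempty →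
          x a ∈ demandSet {0, coalVec a} (fun z => if z = coalVec a then v a else 0) p) ∧
        (∑ a ∈ Finset.univ.filter (fun a : Finset (Fin n) => a.Nonempty), x a)
          = fun _ : Fin n => (1 : ℤ)) := by
  classical
  constructor
  · rintro ⟨P, u, hne, hP, -, heq, hle⟩
    refine ⟨u, fun a => if a ∈ P then coalVec a else 0, fun a ha => ?_, ?_⟩
    · rw [mem_demandSet_coalVec ha]
      by_cases h : a ∈ P
      · exact Or.inl ⟨if_pos h, (heq a h).le⟩
      · exact Or.inr ⟨if_neg h, hle a ha⟩
    · rw [← Finset.sum_filter, ← (sum_coalVec_eq_one_iff P).2 hP]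
      congr 1
      ext a
      simpa using hne a
  · rintro ⟨p, x, hx, hsum⟩
    have hx' := fun a ha => (mem_demandSet_coalVec ha (v a) p (x a)).1 (hx a ha)
    set P := (Finset.univ.filter fun a : Finset (Fin n) => a.Nonempty).filter
      fun a => x a = coalVec a with hPdef
    have hmem : ∀ a, a ∈ P ↔ a.Nonempty ∧ x a = coalVec a := by simp [hPdef]
    have hne : ∀ a ∈ P, a.Nonempty := fun a ha => ((hmem a).1 ha).1
    have hpart : ∀ i, ∃! a, a ∈ P ∧ i ∈ a := by
      rw [← sum_coalVec_eq_one_iff, ← hsum, hPdef, Finset.sum_filter]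
      refine Finset.sum_congr rfl fun a ha => ?_
      split_ifs with h
      · exact h.symm
      · rcases hx' a (Finset.mem_filter.1 ha).2 with h' | h'
        · exact absurd h'.1 h
        · exact h'.1.symm
    have hp : ∀ a ∈ P, ∑ i ∈ a, p i ≤ v a := by
      intro a ha
      obtain ⟨ha, hxa⟩ := (hmem a).1 ha
      rcases hx' a ha with h | h
      · exact h.2
      · exact absurd (hxa.symm.trans h.1) (coalVec_ne_zero ha)
    obtain ⟨u, hpu, hu⟩ := exists_ge_sum_eq hne hpart hp
    have hcore : ∀ b : Finset (Fin n), b.Nonempty → v b ≤ ∑ i ∈ b, u i := by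
      intro b hb
      by_cases hbP : b ∈ P
      · exact (hu b hbP).ge
      · rcases hx' b hb with h | h
        · exact absurd ((hmem b).2 ⟨hb, h.1⟩) hbP
        · exact h.2.trans (Finset.sum_le_sum fun i _ => hpu i)
    refine ⟨P, u, hne, hpart, fun i => ?_, hu, hcore⟩
    simpa using (hvnn {i}).trans (hcore {i} (Finset.singleton_nonempty i))
end

section
/- Let u^1, …, u^J be utility functions on finite nonempty sets A^1, …, A^J ⊂ ℤ^n. Then the set of prices at which the aggregate demand is not a singleton is the union of the corresponding sets for the individual agents: {p ∈ ℝ^n : |D_{u^1}(p) + ⋯ + D_{u^J}(p)| ≥ 2} = ⋃_{j=1}^J {p ∈ ℝ^n : |D_{u^j}(p)| ≥ 2}. (Equivalently, the tropical hypersurface T_U of the aggregate utility is the union of the tropical hypersurfaces T_{u^j}.) -/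
open Pointwise

theorem demandSet_nonempty {n : ℕ} {A : Finset (Fin n → ℤ)} (hA : A.Nonempty)
    (u : (Fin n → ℤ) → ℝ) (p : Fin n → ℝ) : (demandSet A u p).Nonempty :=
  A.exists_max_image (fun a => u a - dotP p a) hA

theorem sum_update_mem_aggDemand {n J : ℕ} {A : Fin J → Finset (Fin n → ℤ)}
    {u : Fin J → (Fin n → ℤ) → ℝ} {p : Fin n → ℝ} {f : Fin J → Fin n → ℤ}
    (hf : ∀ j, f j ∈ demandSet (A j) (u j) p) {j : Fin J} {a : Fin n → ℤ}
    (ha : a ∈ demandSet (A j) (u j) p) : ∑ i, Function.update f j a i ∈ aggDemand A u p := by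
  refine ⟨Function.update f j a, fun i => ?_, rfl⟩
  rcases eq_or_ne i j with rfl | hij
  · simpa using ha
  · simpa [hij] using hf i

/-- the set of prices at which the aggregate demand set is not a singleton is the
union over agents of the sets of prices at which the individual demand set is not a singleton. -/
theorem stmt10 {n J : ℕ} (A : Fin J → Finset (Fin n → ℤ)) (u : Fin J → (Fin n → ℤ) → ℝ)
    (hA : ∀ j, (A j).Nonempty) :
    {p : Fin n → ℝ | (aggDemand A u p).Nontrivial} =
      ⋃ j : Fin J, {p : Fin n → ℝ | (demandSet (A j) (u j) p).Nontrivial} := by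
  ext p
  simp only [Set.mem_ofPred_eq, Set.mem_iUnion]
  constructor
  · rintro ⟨_, ⟨f, hf, rfl⟩, _, ⟨g, hg, rfl⟩, hne⟩
    obtain ⟨j, hj⟩ : ∃ j, f j ≠ g j := by
      by_contra! h
      exact hne (Finset.sum_congr rfl fun j _ => h j)
    exact ⟨j, f j, hf j, g j, hg j, hj⟩
  · rintro ⟨j, a, ha, b, hb, hab⟩
    choose f hf using fun i => demandSet_nonempty (hA i) (u i) p
    refine ⟨_, sum_update_mem_aggDemand hf ha, _, sum_update_mem_aggDemand hf hb, fun h => hab ?_⟩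
    simpa [Finset.sum_update_of_mem (Finset.mem_univ j)] using h
end

section
/- (Shapley–Shubik / bipartite stable matching with transferable utilities.) Let m, n ≥ 1 and let w : [m] × [n] → ℝ_{≥0}. Then there exist a partial matching M ⊆ [m] × [n] (no two pairs of M share a man or a woman) and payoff functions u : [m] → ℝ_{≥0}, u' : [n] → ℝ_{≥0} such that: u(i) + u'(j) = w(i,j) for every (i,j) ∈ M; u(i) = 0 for every man i unmatched in M and u'(j) = 0 for every woman j unmatched in M; and u(i) + u'(j) ≥ w(i,j) for every pair (i,j) ∈ [m] × [n]. In other words, the bipartite TU matching game always has a core. -/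
open Pointwise

/-- A square nonnegative weight matrix has a nonnegative dual-feasible pair of potentials of minimal
total among all dual-feasible pairs. -/
theorem exists_min_potentials {α : Type*} [Fintype α] [Nonempty α] (W : α → α → ℝ)
    (hW : ∀ a b, 0 ≤ W a b) :
    ∃ u v : α → ℝ, (∀ a, 0 ≤ u a) ∧ (∀ b, 0 ≤ v b) ∧ (∀ a b, W a b ≤ u a + v b) ∧
      ∀ u₁ v₁ : α → ℝ, (∀ a b, W a b ≤ u₁ a + v₁ b) →
        ∑ a, u a + ∑ b, v b ≤ ∑ a, u₁ a + ∑ b, v₁ b := by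
  set T : ℝ := ∑ a, ∑ b, W a b with hT
  have hrow : ∀ a, 0 ≤ ∑ b, W a b := fun a => Finset.sum_nonneg fun b _ => hW a b
  have hT0 : 0 ≤ T := Finset.sum_nonneg fun a _ => hrow a
  let box : Set ((α → ℝ) × (α → ℝ)) := Set.Icc (fun _ => 0, fun _ => 0) (fun _ => T, fun _ => T)
  let feas : Set ((α → ℝ) × (α → ℝ)) := {x | ∀ a b, W a b ≤ x.1 a + x.2 b}
  have hfeas : IsClosed feas := by
    simp only [feas, Set.ofPred_forall]
    exact isClosed_iInter fun a => isClosed_iInter fun b =>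
      isClosed_le continuous_const (by fun_prop)
  have hK : IsCompact (box ∩ feas) := isCompact_Icc.inter_right hfeas
  have hmem : ((fun a => ∑ b, W a b, fun _ => 0) : (α → ℝ) × (α → ℝ)) ∈ box ∩ feas := by
    refine ⟨⟨⟨hrow, fun _ => le_rfl⟩, ⟨fun a => ?_, fun _ => hT0⟩⟩, fun a b => ?_⟩
    · exact Finset.single_le_sum (f := fun a => ∑ b, W a b) (fun a _ => hrow a)
        (Finset.mem_univ a)
    · simpa using Finset.single_le_sum (f := W a) (fun b _ => hW a b) (Finset.mem_univ b)
  obtain ⟨⟨u, v⟩, ⟨⟨⟨hu, hv⟩, -⟩, huv⟩, hmin⟩ := hK.exists_isMinOn ⟨_, hmem⟩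
    (f := fun x => ∑ a, x.1 a + ∑ b, x.2 b) (by fun_prop)
  rw [isMinOn_iff] at hmin
  refine ⟨u, v, hu, hv, huv, ?_⟩
  have hnonneg : ∀ u₁ v₁ : α → ℝ, (∀ a, 0 ≤ u₁ a) → (∀ b, 0 ≤ v₁ b) →
      (∀ a b, W a b ≤ u₁ a + v₁ b) → ∑ a, u a + ∑ b, v b ≤ ∑ a, u₁ a + ∑ b, v₁ b := by
    intro u₁ v₁ hu₁ hv₁ h₁
    by_cases hle : ∑ a, u₁ a + ∑ b, v₁ b ≤ T
    · have hsu : 0 ≤ ∑ a, u₁ a := Finset.sum_nonneg fun a _ => hu₁ a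
      have hsv : 0 ≤ ∑ b, v₁ b := Finset.sum_nonneg fun b _ => hv₁ b
      refine hmin (u₁, v₁) ⟨⟨⟨hu₁, hv₁⟩, ⟨fun a => ?_, fun b => ?_⟩⟩, h₁⟩
      · have := Finset.single_le_sum (f := u₁) (fun a _ => hu₁ a) (Finset.mem_univ a)
        change u₁ a ≤ T
        linarith
      · have := Finset.single_le_sum (f := v₁) (fun b _ => hv₁ b) (Finset.mem_univ b)
        change v₁ b ≤ T
        linarith
    · have := hmin _ hmem
      simp only [Finset.sum_const_zero, add_zero] at this
      linarith
  intro u₁ v₁ h₁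
  obtain ⟨a₀, ha₀⟩ := Finite.exists_min u₁
  have := hnonneg (fun a => u₁ a - u₁ a₀) (fun b => v₁ b + u₁ a₀)
    (fun a => sub_nonneg.2 (ha₀ a)) (fun b => by linarith [hW a₀ b, h₁ a₀ b])
    (fun a b => by linarith [h₁ a b])
  simp only [Finset.sum_sub_distrib, Finset.sum_add_distrib] at this
  linarith

/-- Egerváry's theorem: a square nonnegative weight matrix has nonnegative potentials dominating it
which are tight along some permutation. -/
theorem exists_potentials_tight_perm {α : Type*} [Fintype α] [Nonempty α]
    (W : α → α → ℝ) (hW : ∀ a b, 0 ≤ W a b) :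
    ∃ (u v : α → ℝ) (σ : Equiv.Perm α), (∀ a, 0 ≤ u a) ∧ (∀ b, 0 ≤ v b) ∧
      (∀ a b, W a b ≤ u a + v b) ∧ ∀ a, u a + v (σ a) = W a (σ a) := by
  classical
  obtain ⟨u, v, hu, hv, huv, hmin⟩ := exists_min_potentials W hW
  let t : α → Finset α := fun a => Finset.univ.filter fun b => u a + v b = W a b
  have hall : ∀ s : Finset α, s.card ≤ (s.biUnion t).card := by
    intro s
    by_contra! hlt
    set N := s.biUnion t with hN
    let g : α × α → ℝ := fun x =>
      if 0 < u x.1 + v x.2 - W x.1 x.2 then u x.1 + v x.2 - W x.1 x.2 else 1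
    obtain ⟨x₀, hx₀⟩ := Finite.exists_min g
    have hpos : 0 < g x₀ := by
      simp only [g]
      split_ifs with h
      · exact h
      · exact one_pos
    have hslack : ∀ a ∈ s, ∀ b ∉ N, g x₀ ≤ u a + v b - W a b := by
      intro a ha b hb
      have hne : u a + v b ≠ W a b := fun h =>
        hb (Finset.mem_biUnion.2 ⟨a, ha, by simp [t, h]⟩)
      have h0 : 0 < u a + v b - W a b := sub_pos.2 (lt_of_le_of_ne (huv a b) hne.symm)
      exact (hx₀ (a, b)).trans_eq (if_pos h0)
    have hle := hmin (fun a => u a - if a ∈ s then g x₀ else 0)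
      (fun b => v b + if b ∈ N then g x₀ else 0) (by
        intro a b
        have h1 := huv a b
        by_cases ha : a ∈ s <;> by_cases hb : b ∈ N
        · simp only [ha, hb, if_true]
          linarith
        · have h2 := hslack a ha b hb
          simp only [ha, hb, if_true, if_false]
          linarith
        · simp only [ha, hb, if_true, if_false]
          linarith
        · simp only [ha, hb, if_false]
          linarith)
    simp only [Finset.sum_sub_distrib, Finset.sum_add_distrib, Finset.sum_ite_mem,
      Finset.univ_inter, Finset.sum_const, nsmul_eq_mul] at hle
    have hlt' : (N.card : ℝ) < s.card := by exact_mod_cast hlt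
    nlinarith
  obtain ⟨f, hf, hft⟩ := (Finset.all_card_le_biUnion_card_iff_exists_injective t).1 hall
  refine ⟨u, v, Equiv.ofBijective f (Finite.injective_iff_bijective.1 hf), hu, hv, huv,
    fun a => ?_⟩
  simpa [t] using hft a

/-- Shapley–Shubik: the bipartite TU matching game always has a core. -/
theorem stmt13 (m n : ℕ) (hm : 1 ≤ m) (hn : 1 ≤ n) (w : Fin m → Fin n → ℝ)
    (hw : ∀ i j, 0 ≤ w i j) :
    ∃ (M : Finset (Fin m × Fin n)) (u : Fin m → ℝ) (u' : Fin n → ℝ),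
      (∀ q ∈ M, ∀ r ∈ M, q.1 = r.1 → q = r) ∧
      (∀ q ∈ M, ∀ r ∈ M, q.2 = r.2 → q = r) ∧
      (∀ i, 0 ≤ u i) ∧ (∀ j, 0 ≤ u' j) ∧
      (∀ q ∈ M, u q.1 + u' q.2 = w q.1 q.2) ∧
      (∀ i : Fin m, (∀ q ∈ M, q.1 ≠ i) → u i = 0) ∧
      (∀ j : Fin n, (∀ q ∈ M, q.2 ≠ j) → u' j = 0) ∧
      (∀ i : Fin m, ∀ j : Fin n, w i j ≤ u i + u' j) := by
  have : Nonempty (Fin m ⊕ Fin n) := ⟨Sum.inl ⟨0, hm⟩⟩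
  let W : Fin m ⊕ Fin n → Fin m ⊕ Fin n → ℝ
    | Sum.inl i, Sum.inr j => w i j
    | _, _ => 0
  have hW : ∀ a b, 0 ≤ W a b := by
    rintro (i | j) (i' | j') <;> simp [W, hw]
  obtain ⟨u, v, σ, hu, hv, huv, hσ⟩ := exists_potentials_tight_perm W hW
  refine ⟨Finset.univ.filter fun q => σ (Sum.inl q.1) = Sum.inr q.2, fun i => u (Sum.inl i),
    fun j => v (Sum.inr j), ?_, ?_, fun i => hu _, fun j => hv _, ?_, ?_, ?_,
    fun i j => huv (Sum.inl i) (Sum.inr j)⟩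
  · rintro ⟨i, j⟩ hq ⟨i', j'⟩ hr rfl
    simp only [Finset.mem_filter, Finset.mem_univ, true_and] at hq hr
    rw [Sum.inr_injective (hq.symm.trans hr)]
  · rintro ⟨i, j⟩ hq ⟨i', j'⟩ hr rfl
    simp only [Finset.mem_filter, Finset.mem_univ, true_and] at hq hr
    rw [Sum.inl_injective (σ.injective (hq.trans hr.symm))]
  · rintro ⟨i, j⟩ hq
    simp only [Finset.mem_filter, Finset.mem_univ, true_and] at hq
    simpa [hq, W] using hσ (Sum.inl i)
  · intro i hi
    have h := hσ (Sum.inl i)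
    rcases hc : σ (Sum.inl i) with i' | j
    · rw [hc] at h
      have h0 : u (Sum.inl i) + v (Sum.inl i') = 0 := h
      linarith [hu (Sum.inl i), hv (Sum.inl i')]
    · exact absurd rfl (hi (i, j) (by simpa using hc))
  · intro j hj
    obtain ⟨a, ha⟩ := σ.surjective (Sum.inr j)
    have h := hσ a
    rw [ha] at h
    rcases a with i | j'
    · exact absurd rfl (hj (i, j) (by simpa using ha))
    · have h0 : u (Sum.inr j') + v (Sum.inr j) = 0 := h
      linarith [hu (Sum.inr j'), hv (Sum.inr j)]
end
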